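/- arXiv:2012.08944 — 2 statements merged into one kernel-verified Lean document; each statement's English description precedes it below -/
import Mathlib

section
/- For every integer n ≥ 1, real z and real α: J_0(z) + 2·Σ_{k=1}^∞ (-1)^{kn} J_{2kn}(z)·cos(2knα) = (1/n)·Σ_{ℓ=0}^{n-1} cos(z·cos(α + πℓ/n)). -/
open scoped Real

/-- Bessel function of the first kind of integer order `m`,
defined by `J_m(z) = (1/2π) ∫_0^{2π} e^{i z sin θ - i m θ} dθ`. -/
noncomputable def besselJ (m : ℤ) (z : ℂ) : ℂ :=
  (1 / (2 * Real.pi)) * ∫ θ in (0:ℝ)..(2 * Real.pi),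
    Complex.exp (z * Complex.sin (θ:ℂ) * Complex.I - (m:ℂ) * (θ:ℂ) * Complex.I)

open Complex in
lemma periodic_besselJ_integrand (m : ℤ) (z : ℂ) :
    Function.Periodic (fun θ : ℝ => exp (z * sin (θ : ℂ) * I - (m : ℂ) * (θ : ℂ) * I))
      (2 * π) := by
  intro θ
  have h : exp (-((m : ℂ) * (2 * π * I))) = 1 := by
    rw [exp_neg, exp_int_mul_two_pi_mul_I, inv_one]
  simp only [ofReal_add, ofReal_mul, ofReal_ofNat, sin_add_two_pi]
  rw [← mul_one (exp (z * sin (θ : ℂ) * I - (m : ℂ) * (θ : ℂ) * I)), ← h, ← exp_add]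
  congr 1
  ring

open Complex in
lemma int_mul_besselJ (m : ℤ) (z : ℂ) :
    (m : ℂ) * besselJ m z = z / 2 * (besselJ (m - 1) z + besselJ (m + 1) z) := by
  have hd (θ : ℝ) : HasDerivAt
      (fun θ : ℝ => exp (z * sin (θ : ℂ) * I - (m : ℂ) * (θ : ℂ) * I))
      (exp (z * sin (θ : ℂ) * I - (m : ℂ) * (θ : ℂ) * I) *
        (z * cos (θ : ℂ) * I - (m : ℂ) * I)) θ := by
    have h1 : HasDerivAt (fun w : ℂ => exp (z * sin w * I - (m : ℂ) * w * I))
        (exp (z * sin (θ : ℂ) * I - (m : ℂ) * (θ : ℂ) * I) *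
          (z * cos (θ : ℂ) * I - (m : ℂ) * 1 * I)) (θ : ℂ) :=
      ((((hasDerivAt_sin (θ : ℂ)).const_mul z).mul_const I).sub
        (((hasDerivAt_id (θ : ℂ)).const_mul (m : ℂ)).mul_const I)).cexp
    simpa using h1.comp_ofReal
  have hint := intervalIntegral.integral_eq_sub_of_hasDerivAt (a := 0) (b := 2 * π)
    (fun θ _ => hd θ) (Continuous.intervalIntegrable (by fun_prop) _ _)
  have hper := (periodic_besselJ_integrand m z) 0
  simp only [zero_add] at hper
  rw [hper, sub_self] at hint
  have hsplit : ∀ θ : ℝ, exp (z * sin (θ : ℂ) * I - (m : ℂ) * (θ : ℂ) * I) *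
        (z * cos (θ : ℂ) * I - (m : ℂ) * I) =
      (z / 2 * I) * (exp (z * sin (θ : ℂ) * I - ((m - 1 : ℤ) : ℂ) * (θ : ℂ) * I) +
        exp (z * sin (θ : ℂ) * I - ((m + 1 : ℤ) : ℂ) * (θ : ℂ) * I)) -
      (m * I) * exp (z * sin (θ : ℂ) * I - (m : ℂ) * (θ : ℂ) * I) := by
    intro θ
    have e1 : exp (z * sin (θ : ℂ) * I - ((m - 1 : ℤ) : ℂ) * (θ : ℂ) * I) =
        exp (z * sin (θ : ℂ) * I - (m : ℂ) * (θ : ℂ) * I) * exp (θ * I) := by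
      rw [← exp_add]; congr 1; push_cast; ring
    have e2 : exp (z * sin (θ : ℂ) * I - ((m + 1 : ℤ) : ℂ) * (θ : ℂ) * I) =
        exp (z * sin (θ : ℂ) * I - (m : ℂ) * (θ : ℂ) * I) * exp (-θ * I) := by
      rw [← exp_add]; congr 1; push_cast; ring
    rw [e1, e2, cos]
    ring
  simp_rw [hsplit] at hint
  have hi (k : ℤ) : IntervalIntegrable
      (fun θ : ℝ => exp (z * sin (θ : ℂ) * I - (k : ℂ) * (θ : ℂ) * I))
      MeasureTheory.volume 0 (2 * π) :=
    Continuous.intervalIntegrable (by fun_prop) _ _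
  rw [intervalIntegral.integral_sub (((hi _).add (hi _)).const_mul _) ((hi _).const_mul _),
    intervalIntegral.integral_const_mul, intervalIntegral.integral_const_mul,
    intervalIntegral.integral_add (hi _) (hi _)] at hint
  unfold besselJ
  linear_combination (1 / (2 * (π : ℂ))) * I * hint +
    (1 / (2 * (π : ℂ))) * (m * (∫ θ in (0:ℝ)..(2 * π),
      exp (z * sin (θ : ℂ) * I - (m : ℂ) * (θ : ℂ) * I)) - z / 2 *
      ((∫ θ in (0:ℝ)..(2 * π), exp (z * sin (θ : ℂ) * I - ((m - 1 : ℤ) : ℂ) * (θ : ℂ) * I)) +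
      ∫ θ in (0:ℝ)..(2 * π), exp (z * sin (θ : ℂ) * I - ((m + 1 : ℤ) : ℂ) * (θ : ℂ) * I))) *
      I_sq

open Complex in
lemma norm_besselJ_le_one (m : ℤ) (z : ℝ) : ‖besselJ m z‖ ≤ 1 := by
  have h : ‖∫ θ in (0:ℝ)..(2 * π),
      exp ((z : ℂ) * sin (θ : ℂ) * I - (m : ℂ) * (θ : ℂ) * I)‖ ≤ 1 * |2 * π - 0| := by
    refine intervalIntegral.norm_integral_le_of_norm_le_const fun θ _ => le_of_eq ?_
    have : (z : ℂ) * sin (θ : ℂ) * I - (m : ℂ) * (θ : ℂ) * I =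
        ((z * Real.sin θ - m * θ : ℝ) : ℂ) * I := by
      push_cast; ring
    rw [this, norm_exp_ofReal_mul_I]
  have hp : 0 < 2 * π := Real.two_pi_pos
  rw [sub_zero, one_mul, abs_of_pos hp] at h
  have hc : (1 / (2 * (π : ℂ))) = ((1 / (2 * π) : ℝ) : ℂ) := by push_cast; rfl
  rw [besselJ, norm_mul, hc, norm_real, Real.norm_of_nonneg (by positivity)]
  calc 1 / (2 * π) * _ ≤ 1 / (2 * π) * (2 * π) := by gcongr
    _ = 1 := by field_simp

lemma abs_mul_norm_besselJ_le (m : ℤ) (z : ℝ) : |(m : ℝ)| * ‖besselJ m z‖ ≤ |z| := by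
  have h := congrArg norm (int_mul_besselJ m z)
  rw [norm_mul, norm_mul, norm_div, Complex.norm_real, Complex.norm_intCast,
    Complex.norm_ofNat, Real.norm_eq_abs] at h
  rw [h]
  have h2 := norm_add_le (besselJ (m - 1) z) (besselJ (m + 1) z)
  have h3 := norm_besselJ_le_one (m - 1) z
  have h4 := norm_besselJ_le_one (m + 1) z
  calc |z| / 2 * _ ≤ |z| / 2 * 2 := by gcongr; linarith
    _ = |z| := by ring

/-- The weights `m² J_m(z)` are bounded in `m`. -/
lemma sq_mul_norm_besselJ_le (m : ℤ) (z : ℝ) :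
    (m : ℝ) ^ 2 * ‖besselJ m z‖ ≤ |z| * (|z| + 1) := by
  have h := congrArg norm (int_mul_besselJ m z)
  rw [norm_mul, norm_mul, norm_div, Complex.norm_real, Complex.norm_intCast,
    Complex.norm_ofNat, Real.norm_eq_abs] at h
  have hshift (k : ℤ) (hk : |(m : ℝ)| ≤ |(k : ℝ)| + 1) :
      |(m : ℝ)| * ‖besselJ k z‖ ≤ |z| + 1 := by
    have h1 := norm_besselJ_le_one k z
    have h2 := abs_mul_norm_besselJ_le k z
    nlinarith [norm_nonneg (besselJ k z)]
  have h1 := hshift (m - 1) (by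
    have := abs_add_le ((m : ℝ) - 1) 1
    push_cast; simpa using this)
  have h2 := hshift (m + 1) (by
    have := abs_add_le ((m : ℝ) + 1) (-1)
    push_cast; simpa using this)
  have h3 := norm_add_le (besselJ (m - 1) z) (besselJ (m + 1) z)
  calc (m : ℝ) ^ 2 * ‖besselJ m z‖ = |(m : ℝ)| * (|(m : ℝ)| * ‖besselJ m z‖) := by
        rw [← sq_abs]; ring
    _ = |z| / 2 * (|(m : ℝ)| * ‖besselJ (m - 1) z + besselJ (m + 1) z‖) := by rw [h]; ring
    _ ≤ |z| / 2 * (|(m : ℝ)| * (‖besselJ (m - 1) z‖ + ‖besselJ (m + 1) z‖)) := by gcongr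
    _ ≤ |z| / 2 * (2 * (|z| + 1)) := by
        refine mul_le_mul_of_nonneg_left ?_ (by positivity)
        linarith
    _ = |z| * (|z| + 1) := by ring

lemma summable_besselJ (z : ℝ) : Summable fun m : ℤ => besselJ m z := by
  have hs : Summable fun m : ℤ => |z| * (|z| + 1) * (1 / (m : ℝ) ^ 2) :=
    (Real.summable_one_div_int_pow.2 one_lt_two).mul_left _
  refine Summable.of_norm_bounded_eventually hs ?_
  filter_upwards [(Set.finite_singleton (0 : ℤ)).compl_mem_cofinite] with m hm
  have hm0 : (m : ℝ) ≠ 0 := by exact_mod_cast hm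
  rw [mul_one_div, le_div_iff₀ (by positivity), mul_comm]
  exact sq_mul_norm_besselJ_le m z

open Complex in
/-- The Jacobi–Anger expansion. -/
lemma hasSum_besselJ_mul_exp (z θ : ℝ) :
    HasSum (fun m : ℤ => besselJ m z * exp (m * θ * I)) (exp (z * sin (θ : ℂ) * I)) := by
  have hpos : Fact (0 < 2 * π) := ⟨Real.two_pi_pos⟩
  have hper : Function.Periodic (fun θ : ℝ => exp ((z : ℂ) * sin (θ : ℂ) * I)) (2 * π) := by
    intro θ
    simp [sin_add_two_pi]
  let f : C(AddCircle (2 * π), ℂ) :=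
    ⟨hper.lift, continuous_coinduced_dom.mpr (by
      change Continuous fun θ : ℝ => exp ((z : ℂ) * sin (θ : ℂ) * I)
      fun_prop)⟩
  have hf (x : ℝ) : f (x : AddCircle (2 * π)) = exp ((z : ℂ) * sin (x : ℂ) * I) := rfl
  have hcoeff : fourierCoeff f = fun m : ℤ => besselJ m z := by
    funext m
    rw [fourierCoeff_eq_intervalIntegral f m 0, besselJ, zero_add, Complex.real_smul]
    push_cast
    congr 1
    refine intervalIntegral.integral_congr fun x _ => ?_
    simp only [hf, fourier_coe_apply, smul_eq_mul]
    rw [← exp_add]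
    congr 1
    have : (π : ℂ) ≠ 0 := by exact_mod_cast Real.pi_ne_zero
    push_cast
    field_simp
    ring
  have h := has_pointwise_sum_fourier_series_of_summable (f := f)
    (hcoeff ▸ summable_besselJ z) (θ : AddCircle (2 * π))
  rw [hf, hcoeff] at h
  convert h using 2 with m
  rw [fourier_coe_apply, smul_eq_mul]
  congr 2
  have : (π : ℂ) ≠ 0 := by exact_mod_cast Real.pi_ne_zero
  push_cast
  field_simp

open Complex in
lemma besselJ_neg (m : ℤ) (z : ℂ) : besselJ (-m) z = (-1) ^ m * besselJ m z := by
  have hpi : exp ((m : ℂ) * (π * I)) = (-1) ^ m := by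
    rw [exp_int_mul, exp_pi_mul_I]
  have hrefl (θ : ℝ) : exp (z * sin (θ : ℂ) * I - ((-m : ℤ) : ℂ) * (θ : ℂ) * I) =
      (-1) ^ m * exp (z * sin ((π - θ : ℝ) : ℂ) * I - (m : ℂ) * ((π - θ : ℝ) : ℂ) * I) := by
    rw [← hpi, ← exp_add]
    push_cast
    rw [sin_pi_sub]
    congr 1
    ring
  unfold besselJ
  simp_rw [hrefl]
  rw [intervalIntegral.integral_const_mul, intervalIntegral.integral_comp_sub_left
    (fun θ : ℝ => exp (z * sin (θ : ℂ) * I - (m : ℂ) * (θ : ℂ) * I))]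
  have hp := (periodic_besselJ_integrand m z).intervalIntegral_add_eq (π - 2 * π) 0
  rw [sub_add_cancel, zero_add] at hp
  rw [sub_zero, hp]
  ring

open Complex in
/-- Averaging the character `θ ↦ exp(imθ)` over the `N`-th roots of unity. -/
lemma sum_exp_int_mul_add (N : ℕ) (hN : N ≠ 0) (m : ℤ) (θ : ℝ) :
    ∑ ℓ ∈ Finset.range N, exp (m * ((θ + 2 * π * ℓ / N : ℝ) : ℂ) * I) =
      if (N : ℤ) ∣ m then N * exp (m * θ * I) else 0 := by
  have hN' : (N : ℂ) ≠ 0 := by exact_mod_cast hN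
  set r : ℂ := exp (m * (2 * π * I) / N) with hr
  have hterm (ℓ : ℕ) : exp (m * ((θ + 2 * π * ℓ / N : ℝ) : ℂ) * I) =
      exp (m * θ * I) * r ^ ℓ := by
    rw [hr, ← exp_nat_mul, ← exp_add]
    congr 1
    push_cast
    ring
  have hrN : r ^ N = 1 := by
    rw [hr, ← exp_nat_mul, mul_div_cancel₀ _ hN', exp_int_mul_two_pi_mul_I]
  simp_rw [hterm]
  rw [← Finset.mul_sum]
  split_ifs with hdvd
  · obtain ⟨k, rfl⟩ := hdvd
    have hr1 : r = 1 := by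
      rw [hr, ← exp_int_mul_two_pi_mul_I k]
      congr 1
      push_cast
      field_simp
    simp [hr1, mul_comm]
  · have hr1 : r ≠ 1 := by
      intro h
      obtain ⟨k, hk⟩ := exp_eq_one_iff.1 h
      apply hdvd
      refine ⟨k, ?_⟩
      have hpi : (2 * π * I : ℂ) ≠ 0 := two_pi_I_ne_zero
      rw [div_eq_iff hN'] at hk
      have : (m : ℂ) = N * k := mul_right_cancel₀ hpi (by linear_combination hk)
      exact_mod_cast this
    rw [geom_sum_eq hr1, hrN, sub_self, zero_div, mul_zero]

open Complex in
/-- The Jacobi–Anger expansion averaged over the `N`-th roots of unity. -/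
lemma hasSum_besselJ_mul_exp_dilate (N : ℕ) (hN : N ≠ 0) (z θ : ℝ) :
    HasSum (fun k : ℤ => besselJ (N * k) z * exp ((N * k : ℤ) * θ * I))
      (1 / (N : ℂ) * ∑ ℓ ∈ Finset.range N,
        exp (z * sin ((θ + 2 * π * ℓ / N : ℝ) : ℂ) * I)) := by
  have hN' : (N : ℂ) ≠ 0 := by exact_mod_cast hN
  have h := (hasSum_sum fun ℓ (_ : ℓ ∈ Finset.range N) =>
    hasSum_besselJ_mul_exp z (θ + 2 * π * ℓ / N)).mul_left (1 / (N : ℂ))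
  simp_rw [← Finset.mul_sum, sum_exp_int_mul_add N hN] at h
  have hinj : Function.Injective fun k : ℤ => (N : ℤ) * k :=
    mul_right_injective₀ (by exact_mod_cast hN)
  rw [← hinj.hasSum_iff] at h
  · refine HasSum.congr_fun h fun k => ?_
    simp only [Function.comp_apply, dvd_mul_right, if_true]
    field_simp
  · intro m hm
    rw [if_neg fun ⟨k, hk⟩ => hm ⟨k, hk.symm⟩]
    simp

open Complex in
lemma sum_range_two_mul_exp_cos (n : ℕ) (hn : n ≠ 0) (z α : ℝ) :
    ∑ ℓ ∈ Finset.range (2 * n),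
        exp (z * sin ((α + π / 2 + 2 * π * ℓ / (2 * n : ℕ) : ℝ) : ℂ) * I) =
      2 * ∑ ℓ ∈ Finset.range n, (Real.cos (z * Real.cos (α + π * ℓ / n)) : ℂ) := by
  have hn' : (n : ℝ) ≠ 0 := by exact_mod_cast hn
  have hterm (ℓ : ℕ) : exp (z * sin ((α + π / 2 + 2 * π * ℓ / (2 * n : ℕ) : ℝ) : ℂ) * I) =
      exp (((z * Real.cos (α + π * ℓ / n) : ℝ) : ℂ) * I) := by
    have : α + π / 2 + 2 * π * ℓ / (2 * n : ℕ) = α + π * ℓ / n + π / 2 := by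
      push_cast
      field_simp
      ring
    rw [this, ← ofReal_sin, Real.sin_add_pi_div_two, ofReal_mul]
  have hshift (ℓ : ℕ) : Real.cos (α + π * (n + ℓ : ℕ) / n) = -Real.cos (α + π * ℓ / n) := by
    rw [← Real.cos_add_pi]
    congr 1
    push_cast
    field_simp
    ring
  simp_rw [hterm]
  rw [two_mul n, Finset.sum_range_add, ← Finset.sum_add_distrib, Finset.mul_sum]
  refine Finset.sum_congr rfl fun ℓ _ => ?_
  rw [hshift, ofReal_cos, two_cos, mul_neg, ofReal_neg]

theorem statement4 (n : ℕ) (hn : 1 ≤ n) (z α : ℝ) :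
    besselJ 0 z + 2 * ∑' k : ℕ,
        (-1 : ℂ) ^ ((k + 1) * n) * besselJ (2 * (k + 1) * n) z *
          (Real.cos (2 * (k + 1) * n * α) : ℂ) =
      (1 / (n:ℂ)) * ∑ ℓ ∈ Finset.range n, (Real.cos (z * Real.cos (α + π * ℓ / n)) : ℂ) := by
  have hn0 : n ≠ 0 := by omega
  have h := hasSum_besselJ_mul_exp_dilate (2 * n) (by omega) z (α + π / 2)
  rw [sum_range_two_mul_exp_cos n hn0] at h
  have hpair := h.nat_add_neg
  rw [← hasSum_nat_add_iff' 1] at hpair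
  have hterm (k : ℕ) :
      besselJ (((2 * n : ℕ) : ℤ) * ((k + 1 : ℕ) : ℤ)) z * Complex.exp
          (((((2 * n : ℕ) : ℤ) * ((k + 1 : ℕ) : ℤ) : ℤ) : ℂ) * ((α + π / 2 : ℝ) : ℂ) * Complex.I) +
        besselJ (((2 * n : ℕ) : ℤ) * -((k + 1 : ℕ) : ℤ)) z * Complex.exp
          (((((2 * n : ℕ) : ℤ) * -((k + 1 : ℕ) : ℤ) : ℤ) : ℂ) * ((α + π / 2 : ℝ) : ℂ) *
            Complex.I) =
      2 * ((-1 : ℂ) ^ ((k + 1) * n) * besselJ (2 * (k + 1) * n) z *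
          (Real.cos (2 * (k + 1) * n * α) : ℂ)) := by
    have hidx : ((2 * n : ℕ) : ℤ) * ((k + 1 : ℕ) : ℤ) = 2 * (k + 1) * n := by
      push_cast; ring
    have heven : (-1 : ℂ) ^ (2 * ((k : ℤ) + 1) * n) = 1 :=
      Even.neg_one_zpow ⟨((k : ℤ) + 1) * n, by ring⟩
    have hpos : Complex.exp (((k + 1) * n : ℕ) * (π * Complex.I)) = (-1) ^ ((k + 1) * n) := by
      rw [Complex.exp_nat_mul, Complex.exp_pi_mul_I]
    have hneg : Complex.exp (-(((k + 1) * n : ℕ) * (π * Complex.I))) =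
        (-1) ^ ((k + 1) * n) := by
      rw [Complex.exp_neg, hpos, ← inv_pow, inv_neg_one]
    rw [mul_neg, besselJ_neg, hidx, heven, one_mul, ← mul_add]
    have e1 : Complex.exp (((2 * ((k : ℤ) + 1) * n : ℤ) : ℂ) * ((α + π / 2 : ℝ) : ℂ) *
        Complex.I) = (-1) ^ ((k + 1) * n) *
          Complex.exp (((2 * (k + 1) * n * α : ℝ) : ℂ) * Complex.I) := by
      rw [← hpos, ← Complex.exp_add]
      congr 1
      push_cast
      ring
    have e2 : Complex.exp (((-(2 * ((k : ℤ) + 1) * n) : ℤ) : ℂ) * ((α + π / 2 : ℝ) : ℂ) *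
        Complex.I) = (-1) ^ ((k + 1) * n) *
          Complex.exp (-((2 * (k + 1) * n * α : ℝ) : ℂ) * Complex.I) := by
      rw [← hneg, ← Complex.exp_add]
      congr 1
      push_cast
      ring
    rw [e1, e2, Complex.ofReal_cos, Complex.cos]
    ring
  simp_rw [hterm] at hpair
  rw [← tsum_mul_left, hpair.tsum_eq]
  have hn' : (n : ℂ) ≠ 0 := by exact_mod_cast hn0
  simp
  field_simp
end

section
/- For every integer n ≥ 1 and real x: J_0(x)² + 2·Σ_{k=1}^∞ J_{2kn}(x)² = 1/(2n) + (1/(2n))·J_0(2x) + (1/n)·Σ_{k=1}^{n-1} J_0(2x·cos(πk/(2n))). -/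
open scoped Real

open MeasureTheory AddCircle ComplexConjugate

/-- **Parseval's identity** for a pair of continuous functions on the circle. -/
theorem hasSum_conj_fourierCoeff_mul {T : ℝ} [Fact (0 < T)] (f g : C(AddCircle T, ℂ)) :
    HasSum (fun m : ℤ ↦ conj (fourierCoeff f m) * fourierCoeff g m)
      (∫ t, g t * conj (f t) ∂haarAddCircle) := by
  have h := fourierBasis.hasSum_inner_mul_inner
    (ContinuousMap.toLp 2 haarAddCircle ℂ f) (ContinuousMap.toLp 2 haarAddCircle ℂ g)
  rw [ContinuousMap.inner_toLp] at h
  simp_rw [← inner_conj_symm (ContinuousMap.toLp 2 haarAddCircle ℂ f),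
    ← HilbertBasis.repr_apply_apply, fourierBasis_repr, fourierCoeff_toLp] at h
  exact h

/-- The integrand defining `besselJ`. -/
noncomputable def besselKernel (m : ℤ) (z : ℂ) (θ : ℝ) : ℂ :=
  Complex.exp (z * Complex.sin (θ : ℂ) * Complex.I - (m : ℂ) * (θ : ℂ) * Complex.I)

theorem besselKernel_periodic (m : ℤ) (z : ℂ) :
    Function.Periodic (besselKernel m z) (2 * π) := by
  intro θ
  unfold besselKernel
  push_cast
  rw [Complex.sin_add_two_pi, Complex.exp_eq_exp_iff_exists_int]
  exact ⟨-m, by push_cast; ring⟩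

/-- The interval of integration in `besselJ` may be any period. -/
theorem besselJ_eq_integral (m : ℤ) (z : ℂ) (a : ℝ) :
    besselJ m z = (1 / (2 * π)) * ∫ θ in a..a + 2 * π, besselKernel m z θ := by
  rw [(besselKernel_periodic m z).intervalIntegral_add_eq a 0, zero_add]
  rfl

theorem conj_besselJ_ofReal (m : ℤ) (x : ℝ) : conj (besselJ m x) = besselJ m x := by
  have h : conj (∫ θ in (0 : ℝ)..(0 + 2 * π), besselKernel m x θ)
      = ∫ θ in (-(2 * π))..(-(2 * π) + 2 * π), besselKernel m x θ := by
    rw [← intervalIntegral.intervalIntegral_conj]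
    have := intervalIntegral.integral_comp_neg (a := 0) (b := 2 * π) (besselKernel m x)
    rw [neg_zero] at this
    rw [zero_add, neg_add_cancel, ← this]
    refine intervalIntegral.integral_congr fun θ _ ↦ ?_
    simp only [besselKernel, ← Complex.exp_conj]
    congr 1
    simp [← Complex.sin_conj]
  calc conj (besselJ m x)
      = conj (1 / (2 * π) * ∫ θ in (0 : ℝ)..(0 + 2 * π), besselKernel m x θ) := by
        rw [← besselJ_eq_integral]
    _ = besselJ m x := by
        rw [map_mul, h, besselJ_eq_integral m x (-(2 * π))]
        simp [Complex.conj_ofNat]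

theorem besselJ_neg_of_even {m : ℤ} (hm : Even m) (z : ℂ) : besselJ (-m) z = besselJ m z := by
  obtain ⟨k, rfl⟩ := hm
  rw [besselJ_eq_integral _ z (-π), besselJ_eq_integral _ z 0]
  congr 1
  have := intervalIntegral.integral_comp_sub_left (a := 0) (b := 2 * π)
    (besselKernel (-(k + k)) z) π
  rw [show -π + 2 * π = π - 0 by ring, show -π = π - 2 * π by ring, ← this, zero_add]
  refine intervalIntegral.integral_congr fun θ _ ↦ ?_
  simp only [besselKernel]
  push_cast
  rw [Complex.sin_pi_sub, Complex.exp_eq_exp_iff_exists_int]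
  exact ⟨k, by ring⟩

instance fact_zero_lt_two_pi : Fact (0 < 2 * π) := ⟨Real.two_pi_pos⟩

/-- The function `θ ↦ exp (i x sin (θ + φ))` on the circle. -/
noncomputable def expSinShift (x φ : ℝ) : C(AddCircle (2 * π), ℂ) where
  toFun t := Complex.exp (x * (Real.Angle.sin (t + (φ : AddCircle (2 * π))) : ℝ) * Complex.I)
  continuous_toFun := by
    have : Continuous fun t : AddCircle (2 * π) ↦
        Real.Angle.sin (t + (φ : AddCircle (2 * π))) :=
      Real.Angle.continuous_sin.comp (continuous_add_const _)
    fun_prop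

theorem expSinShift_coe (x φ θ : ℝ) :
    expSinShift x φ (θ : AddCircle (2 * π)) =
      Complex.exp (x * Complex.sin (θ + φ) * Complex.I) := by
  have : Real.Angle.sin ((θ : AddCircle (2 * π)) + (φ : AddCircle (2 * π))) = Real.sin (θ + φ) :=
    Real.Angle.sin_coe (θ + φ)
  simp [expSinShift, this]

theorem fourierCoeff_expSinShift (x φ : ℝ) (m : ℤ) :
    fourierCoeff (expSinShift x φ) m = Complex.exp (m * φ * Complex.I) * besselJ m x := by
  have h := intervalIntegral.integral_comp_add_right (a := 0) (b := 0 + 2 * π)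
    (besselKernel m x) φ
  rw [fourierCoeff_eq_intervalIntegral _ _ 0, besselJ_eq_integral m x (0 + φ), add_right_comm,
    ← h, mul_left_comm, ← intervalIntegral.integral_const_mul, Complex.real_smul]
  congr 1
  · simp
  refine intervalIntegral.integral_congr fun θ _ ↦ ?_
  simp only [expSinShift_coe, besselKernel, fourier_coe_apply, smul_eq_mul, ← Complex.exp_add]
  congr 1
  push_cast
  field_simp
  ring

theorem integral_expSinShift (x φ : ℝ) :
    ∫ t, expSinShift x φ t * conj (expSinShift x 0 t) ∂haarAddCircle =
      besselJ 0 ((2 * x * Real.sin (φ / 2) : ℝ) : ℂ) := by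
  have h := intervalIntegral.integral_comp_add_right (a := 0) (b := 0 + 2 * π)
    (besselKernel 0 ((2 * x * Real.sin (φ / 2) : ℝ) : ℂ)) ((φ + π) / 2)
  rw [integral_haarAddCircle, ← AddCircle.intervalIntegral_preimage (2 * π) 0,
    besselJ_eq_integral 0 _ (0 + (φ + π) / 2), add_right_comm, ← h, Complex.real_smul]
  congr 1
  · simp
  refine intervalIntegral.integral_congr fun θ _ ↦ ?_
  have hs : Complex.sin (θ + φ) - Complex.sin θ =
      2 * Complex.sin (φ / 2) * Complex.sin (θ + (φ + π) / 2) := by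
    rw [Complex.sin_sub_sin, add_div (φ : ℂ), ← add_assoc, Complex.sin_add_pi_div_two]
    congr 3 <;> ring
  simp only [expSinShift_coe, besselKernel, ← Complex.exp_conj, ← Complex.exp_add]
  congr 1
  simp [← Complex.sin_conj]
  linear_combination x * Complex.I * hs

/-- Neumann's addition theorem: `∑ J_m(x)² exp (i m φ) = J_0(2 x sin (φ / 2))`. -/
theorem hasSum_besselJ_sq_mul_exp (x φ : ℝ) :
    HasSum (fun m : ℤ ↦ besselJ m x ^ 2 * Complex.exp (m * φ * Complex.I))
      (besselJ 0 ((2 * x * Real.sin (φ / 2) : ℝ) : ℂ)) := by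
  have h := hasSum_conj_fourierCoeff_mul (expSinShift x 0) (expSinShift x φ)
  rw [integral_expSinShift] at h
  convert! h using 2 with m
  simp [fourierCoeff_expSinShift, conj_besselJ_ofReal]
  ring

theorem sum_range_exp_div (N : ℕ) (hN : N ≠ 0) (m : ℤ) :
    ∑ j ∈ Finset.range N, Complex.exp (m * ((2 * π * j / N : ℝ) : ℂ) * Complex.I) =
      if (N : ℤ) ∣ m then (N : ℂ) else 0 := by
  have hN' : (N : ℂ) ≠ 0 := by exact_mod_cast hN
  set ζ : ℂ := Complex.exp (m * (2 * π / N) * Complex.I) with hζ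
  have hpow (j : ℕ) : Complex.exp (m * ((2 * π * j / N : ℝ) : ℂ) * Complex.I) = ζ ^ j := by
    rw [hζ, ← Complex.exp_nat_mul]
    congr 1
    push_cast
    ring
  have hone : ζ = 1 ↔ (N : ℤ) ∣ m := by
    rw [hζ, Complex.exp_eq_one_iff]
    refine exists_congr fun k ↦ ?_
    rw [← Int.cast_inj (α := ℂ)]
    have h2 : (2 * π * Complex.I : ℂ) ≠ 0 := Complex.two_pi_I_ne_zero
    have : (m : ℂ) * (2 * π / N) * Complex.I = m / N * (2 * π * Complex.I) := by ring
    rw [this, mul_left_inj' h2, div_eq_iff hN']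
    push_cast
    rw [mul_comm]
  simp_rw [hpow]
  split_ifs with hm
  · simp [hone.2 hm]
  · have hN1 : ζ ^ N = 1 := by
      rw [← hpow, Complex.exp_eq_one_iff]
      exact ⟨m, by push_cast; field_simp⟩
    rw [geom_sum_eq (mt hone.1 hm), hN1]
    simp

/-- Averaging the addition theorem over the `N`-th roots of unity. -/
theorem hasSum_besselJ_mul_sq (N : ℕ) (hN : N ≠ 0) (x : ℝ) :
    HasSum (fun k : ℤ ↦ besselJ (N * k) x ^ 2)
      (1 / (N : ℂ) * ∑ j ∈ Finset.range N,
        besselJ 0 ((2 * x * Real.sin (π * j / N) : ℝ) : ℂ)) := by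
  have hN' : (N : ℂ) ≠ 0 := by exact_mod_cast hN
  have h := (hasSum_sum fun j (_ : j ∈ Finset.range N) ↦
    hasSum_besselJ_sq_mul_exp x (2 * π * j / N)).mul_left (1 / (N : ℂ))
  simp_rw [← Finset.mul_sum, sum_range_exp_div N hN] at h
  have hinj : Function.Injective fun k : ℤ ↦ (N : ℤ) * k :=
    mul_right_injective₀ (by exact_mod_cast hN)
  rw [← hinj.hasSum_iff] at h
  · convert! h using 2 with k
    · simp only [Function.comp_apply, dvd_mul_right, if_true]
      field_simp
    · congr! 5
      ring
  · intro m hm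
    rw [if_neg fun ⟨k, hk⟩ ↦ hm ⟨k, hk.symm⟩]
    simp

theorem besselJ_zero_zero : besselJ 0 0 = 1 := by
  have : (π : ℂ) ≠ 0 := by exact_mod_cast Real.pi_ne_zero
  simp [besselJ]
  field_simp

theorem sum_range_two_mul_sin (n : ℕ) (hn : 1 ≤ n) (F : ℝ → ℂ) :
    ∑ j ∈ Finset.range (2 * n), F (Real.sin (π * j / (2 * n : ℕ))) =
      F 0 + F 1 + 2 * ∑ k ∈ Finset.Ico 1 n, F (Real.cos (π * k / (2 * n))) := by
  have hn' : (n : ℝ) ≠ 0 := by positivity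
  have hlow : ∑ j ∈ Finset.Ico 1 n, F (Real.sin (π * j / (2 * n : ℕ))) =
      ∑ k ∈ Finset.Ico 1 n, F (Real.cos (π * k / (2 * n))) := by
    refine Finset.sum_nbij' (n - ·) (n - ·) ?_ ?_ ?_ ?_ ?_ <;> intro j hj <;>
      rw [Finset.mem_Ico] at hj
    · simp only [Finset.mem_Ico]; omega
    · simp only [Finset.mem_Ico]; omega
    · omega
    · omega
    · rw [← Real.cos_pi_div_two_sub, Nat.cast_sub hj.2.le]
      push_cast
      congr 2
      field_simp
  have hhigh : ∑ j ∈ Finset.Ico (n + 1) (2 * n), F (Real.sin (π * j / (2 * n : ℕ))) =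
      ∑ k ∈ Finset.Ico 1 n, F (Real.cos (π * k / (2 * n))) := by
    refine Finset.sum_nbij' (· - n) (· + n) ?_ ?_ ?_ ?_ ?_ <;> intro j hj <;>
      rw [Finset.mem_Ico] at hj
    · simp only [Finset.mem_Ico]; omega
    · simp only [Finset.mem_Ico]; omega
    · omega
    · omega
    · rw [← Real.sin_add_pi_div_two, Nat.cast_sub (by omega)]
      push_cast
      congr 2
      field_simp
      ring
  rw [Finset.range_eq_Ico, Finset.sum_eq_sum_Ico_succ_bot (by omega),
    ← Finset.sum_Ico_consecutive _ (show 0 + 1 ≤ n by omega) (show n ≤ 2 * n by omega),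
    Finset.sum_eq_sum_Ico_succ_bot (show n < 2 * n by omega), hhigh, zero_add, hlow]
  have : Real.sin (π * n / (2 * n : ℕ)) = 1 := by
    rw [← Real.sin_pi_div_two]
    push_cast
    congr 1
    field_simp
  rw [this]
  simp
  ring

theorem statement14 (n : ℕ) (hn : 1 ≤ n) (x : ℝ) :
    besselJ 0 x ^ 2 + 2 * ∑' k : ℕ, besselJ (2 * (k + 1) * n) x ^ 2 =
      1 / (2 * (n:ℂ)) + (1 / (2 * (n:ℂ))) * besselJ 0 ((2 * x : ℝ) : ℂ) +
        (1 / (n:ℂ)) * ∑ k ∈ Finset.Ico 1 n,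
          besselJ 0 ((2 * x * Real.cos (π * k / (2 * n)) : ℝ) : ℂ) := by
  have hn' : (n : ℂ) ≠ 0 := by exact_mod_cast (by omega : n ≠ 0)
  have h := (hasSum_besselJ_mul_sq (2 * n) (by omega) x).nat_add_neg
  have heven (k : ℕ) : besselJ (((2 * n : ℕ) : ℤ) * (-k)) x = besselJ (((2 * n : ℕ) : ℤ) * k) x := by
    rw [mul_neg, besselJ_neg_of_even ⟨n * k, by push_cast; ring⟩]
  simp_rw [heven, ← two_mul] at h
  have ht := h.tsum_eq
  rw [h.summable.tsum_eq_zero_add, tsum_mul_left,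
    sum_range_two_mul_sin n hn fun s ↦ besselJ 0 ((2 * x * s : ℝ) : ℂ)] at ht
  have hterm (k : ℕ) :
      ((2 * n : ℕ) : ℤ) * ((k + 1 : ℕ) : ℤ) = 2 * ((k : ℤ) + 1) * n := by
    push_cast
    ring
  simp_rw [hterm] at ht
  simp only [mul_zero, Nat.cast_zero, Complex.ofReal_zero, besselJ_zero_zero, mul_one] at ht
  linear_combination (norm := skip) ht
  push_cast
  field_simp
  ring
end
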